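/- arXiv:1905.12928 — 2 statements merged into one kernel-verified Lean document; each statement's English description precedes it below -/
import Mathlib

section
/- Let G = (V,E) be a finite graph, β > 0 and h ∈ ℝ. The random-cluster measure with external field ℙ_G satisfies the FKG inequality: for all functions f, g : 𝒫(E) → ℝ that are nondecreasing with respect to inclusion of edge sets, 𝔼_G[f g] ≥ 𝔼_G[f] · 𝔼_G[g]. -/
namespace RC

variable {V E : Type} [Fintype V] [DecidableEq V] [Fintype E] [DecidableEq E]

/-- `a` and `b` are joined by a path of `ω`-open edges (graph with edge-endpoint map `ends`). -/
def Connected (ends : E → Sym2 V) (ω : Finset E) (a b : V) : Prop :=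
  Relation.ReflTransGen (fun x y => ∃ e ∈ ω, ends e = s(x, y)) a b

open Classical in
/-- The `ω`-cluster of the vertex `v`. -/
noncomputable def cluster (ends : E → Sym2 V) (ω : Finset E) (v : V) : Finset V :=
  Finset.univ.filter (fun w => Connected ends ω v w)

open Classical in
/-- The set of clusters (connected components) of `(V, ω)`. -/
noncomputable def clusters (ends : E → Sym2 V) (ω : Finset E) : Finset (Finset V) :=
  Finset.univ.image (cluster ends ω)

/-- Unnormalized random-cluster weight with external field:
`(e^{2β}-1)^{|ω|} ∏_{C ∈ cl(ω)} (e^{h|C|} + e^{-h|C|})`. -/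
noncomputable def rcWeight (β h : ℝ) (ends : E → Sym2 V) (ω : Finset E) : ℝ :=
  (Real.exp (2 * β) - 1) ^ ω.card *
    ∏ C ∈ clusters ends ω, (Real.exp (h * C.card) + Real.exp (-(h * C.card)))

noncomputable def rcZ (β h : ℝ) (ends : E → Sym2 V) : ℝ :=
  ∑ ω : Finset E, rcWeight β h ends ω

/-- The random-cluster probability of a single configuration `ω`. -/
noncomputable def rcProb (β h : ℝ) (ends : E → Sym2 V) (ω : Finset E) : ℝ :=
  rcWeight β h ends ω / rcZ β h ends

open Classical in
/-- Random-cluster probability of an event. -/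
noncomputable def rcPr (β h : ℝ) (ends : E → Sym2 V) (A : Finset E → Prop) : ℝ :=
  ∑ ω : Finset E, if A ω then rcProb β h ends ω else 0

/-- Random-cluster expectation. -/
noncomputable def rcExp (β h : ℝ) (ends : E → Sym2 V) (f : Finset E → ℝ) : ℝ :=
  ∑ ω : Finset E, f ω * rcProb β h ends ω

open Classical in
/-- Random-cluster conditional expectation given an event. -/
noncomputable def rcCondExp (β h : ℝ) (ends : E → Sym2 V) (f : Finset E → ℝ)
    (A : Finset E → Prop) : ℝ :=
  (∑ ω : Finset E, if A ω then f ω * rcWeight β h ends ω else 0) /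
    (∑ ω : Finset E, if A ω then rcWeight β h ends ω else 0)

/-- Random-cluster conditional probability `ℙ(A | B)`. -/
noncomputable def rcCondPr (β h : ℝ) (ends : E → Sym2 V) (A B : Finset E → Prop) : ℝ :=
  rcPr β h ends (fun ω => A ω ∧ B ω) / rcPr β h ends B

end RC

namespace RC

variable {V E : Type} [Fintype V] [DecidableEq V] [Fintype E] [DecidableEq E]

lemma conn_refl (ends : E → Sym2 V) (ω : Finset E) (a : V) : Connected ends ω a a :=
  Relation.ReflTransGen.refl

lemma conn_trans {ends : E → Sym2 V} {ω : Finset E} {a b c : V} (h1 : Connected ends ω a b)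
    (h2 : Connected ends ω b c) : Connected ends ω a c :=
  Relation.ReflTransGen.trans h1 h2

lemma conn_symm {ends : E → Sym2 V} {ω : Finset E} {a b : V} (h1 : Connected ends ω a b) :
    Connected ends ω b a := by
  unfold Connected at *
  induction h1 with
  | refl => exact Relation.ReflTransGen.refl
  | tail _ h2 ih =>
    obtain ⟨e, he, hh⟩ := h2
    exact Relation.ReflTransGen.head ⟨e, he, by rw [hh, Sym2.eq_swap]⟩ ih

lemma conn_mono {ends : E → Sym2 V} {ω ω' : Finset E} (hs : ω ⊆ ω') {a b : V}
    (h1 : Connected ends ω a b) : Connected ends ω' a b := by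
  unfold Connected at *
  induction h1 with
  | refl => exact Relation.ReflTransGen.refl
  | tail _ h2 ih =>
    obtain ⟨e, he, hh⟩ := h2
    exact Relation.ReflTransGen.tail ih ⟨e, hs he, hh⟩

lemma conn_edge {ends : E → Sym2 V} {ω : Finset E} {e : E} (he : e ∈ ω) {x y : V}
    (hxy : ends e = s(x, y)) : Connected ends ω x y :=
  Relation.ReflTransGen.single ⟨e, he, hxy⟩

lemma conn_insert {ends : E → Sym2 V} {ω : Finset E} {e : E} {x y : V}
    (hxy : ends e = s(x, y)) (a b : V) :
    Connected ends (insert e ω) a b ↔ Connected ends ω a b ∨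
      (Connected ends ω a x ∧ Connected ends ω y b) ∨
      (Connected ends ω a y ∧ Connected ends ω x b) := by
  constructor
  · intro h1
    induction h1 with
    | refl => exact Or.inl (conn_refl _ _ _)
    | @tail b c _ h2 ih =>
      obtain ⟨e', he', hh⟩ := h2
      rcases Finset.mem_insert.1 he' with rfl | he'
      · rw [hxy] at hh
        rcases Sym2.eq_iff.1 hh with ⟨rfl, rfl⟩ | ⟨rfl, rfl⟩
        · rcases ih with ih | ih | ih
          · exact Or.inr (Or.inl ⟨ih, conn_refl _ _ _⟩)
          · exact Or.inr (Or.inl ⟨ih.1, conn_refl _ _ _⟩)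
          · exact Or.inl ih.1
        · rcases ih with ih | ih | ih
          · exact Or.inr (Or.inr ⟨ih, conn_refl _ _ _⟩)
          · exact Or.inl ih.1
          · exact Or.inr (Or.inr ⟨ih.1, conn_refl _ _ _⟩)
      · have hc : Connected ends ω b c := conn_edge he' hh
        rcases ih with ih | ih | ih
        · exact Or.inl (conn_trans ih hc)
        · exact Or.inr (Or.inl ⟨ih.1, conn_trans ih.2 hc⟩)
        · exact Or.inr (Or.inr ⟨ih.1, conn_trans ih.2 hc⟩)
  · have hs : ω ⊆ insert e ω := Finset.subset_insert _ _
    have he : Connected ends (insert e ω) x y := conn_edge (Finset.mem_insert_self _ _) hxy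
    rintro (h1 | ⟨h1, h2⟩ | ⟨h1, h2⟩)
    · exact conn_mono hs h1
    · exact conn_trans (conn_mono hs h1) (conn_trans he (conn_mono hs h2))
    · exact conn_trans (conn_mono hs h1) (conn_trans (conn_symm he) (conn_mono hs h2))

lemma mem_cluster {ends : E → Sym2 V} {ω : Finset E} {v w : V} :
    w ∈ cluster ends ω v ↔ Connected ends ω v w := by
  simp [cluster]

lemma cluster_eq_iff {ends : E → Sym2 V} {ω : Finset E} {v w : V} :
    cluster ends ω v = cluster ends ω w ↔ Connected ends ω v w := by
  constructor
  · intro h1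
    exact mem_cluster.1 (h1 ▸ mem_cluster.2 (conn_refl _ _ _))
  · intro h1
    ext u
    rw [mem_cluster, mem_cluster]
    exact ⟨conn_trans (conn_symm h1), conn_trans h1⟩

lemma cluster_mono {ends : E → Sym2 V} {ω ω' : Finset E} (hs : ω ⊆ ω') (v : V) :
    cluster ends ω v ⊆ cluster ends ω' v := fun _ hu =>
  mem_cluster.2 (conn_mono hs (mem_cluster.1 hu))

lemma mem_clusters {ends : E → Sym2 V} {ω : Finset E} {C : Finset V} :
    C ∈ clusters ends ω ↔ ∃ v, cluster ends ω v = C := by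
  simp [clusters]

/-- Field factor of a cluster of size `a`. -/
noncomputable def phi (h a : ℝ) : ℝ := Real.exp (h * a) + Real.exp (-(h * a))

lemma phi_pos (h a : ℝ) : 0 < phi h a := by unfold phi; positivity

lemma phi_eq (h a : ℝ) : phi h a = 2 * Real.cosh (h * a) := by
  rw [phi, Real.cosh_eq]; ring

lemma phi_add_le (h a b : ℝ) : phi h (a + b) ≤ phi h a * phi h b := by
  unfold phi
  have h1 : Real.exp (h * (a + b)) = Real.exp (h * a) * Real.exp (h * b) := by
    rw [← Real.exp_add]; ring_nf
  have h2 : Real.exp (-(h * (a + b))) = Real.exp (-(h * a)) * Real.exp (-(h * b)) := by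
    rw [← Real.exp_add]; ring_nf
  rw [h1, h2]
  have := Real.exp_pos (h * a)
  have := Real.exp_pos (h * b)
  have := Real.exp_pos (-(h * a))
  have := Real.exp_pos (-(h * b))
  nlinarith [mul_pos (Real.exp_pos (h * a)) (Real.exp_pos (-(h * b))),
    mul_pos (Real.exp_pos (-(h * a))) (Real.exp_pos (h * b))]

lemma phi_mul (h u v : ℝ) : phi h u * phi h v = phi h (u + v) + phi h (u - v) := by
  simp only [phi, add_mul, mul_add, ← Real.exp_add]
  ring_nf

lemma phi_step (h a a' b : ℝ) (ha : a ≤ a') (hb : 0 ≤ b) :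
    phi h (a + b) * phi h a' ≤ phi h (a' + b) * phi h a := by
  rw [phi_mul, phi_mul]
  have h1 : a + b + a' = a' + b + a := by ring
  rw [h1]
  have h2 : phi h (a + b - a') ≤ phi h (a' + b - a) := by
    rw [phi_eq, phi_eq]
    have : Real.cosh (h * (a + b - a')) ≤ Real.cosh (h * (a' + b - a)) := by
      rw [Real.cosh_le_cosh, abs_mul, abs_mul]
      refine mul_le_mul_of_nonneg_left ?_ (abs_nonneg _)
      rw [abs_of_nonneg (by linarith : 0 ≤ a' + b - a)]
      rw [abs_le]; constructor <;> linarith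
    linarith
  linarith

lemma phi_step2 (h a a' b b' : ℝ) (h0 : 0 ≤ a) (ha : a ≤ a') (hb0 : 0 ≤ b) (hb : b ≤ b') :
    phi h (a + b) * (phi h a' * phi h b') ≤ phi h (a' + b') * (phi h a * phi h b) := by
  have h1 := mul_le_mul_of_nonneg_right (phi_step h a a' b ha hb0) (phi_pos h b').le
  have h2 := mul_le_mul_of_nonneg_right (phi_step h b b' a' hb (h0.trans ha)) (phi_pos h a).le
  rw [add_comm b a', add_comm b' a'] at h2
  nlinarith

/-- The cluster part of the weight. -/
noncomputable def Phi (h : ℝ) (ends : E → Sym2 V) (ω : Finset E) : ℝ :=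
  ∏ C ∈ clusters ends ω, phi h C.card

lemma Phi_pos (h : ℝ) (ends : E → Sym2 V) (ω : Finset E) : 0 < Phi h ends ω :=
  Finset.prod_pos fun _ _ => phi_pos _ _

lemma Phi_insert_conn (h : ℝ) {ends : E → Sym2 V} {ω : Finset E} {e : E} {x y : V}
    (hxy : ends e = s(x, y)) (hc : Connected ends ω x y) :
    Phi h ends (insert e ω) = Phi h ends ω := by
  have : cluster ends (insert e ω) = cluster ends ω := by
    funext v
    ext w
    rw [mem_cluster, mem_cluster, conn_insert hxy]
    constructor
    · rintro (h1 | ⟨h1, h2⟩ | ⟨h1, h2⟩)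
      · exact h1
      · exact conn_trans h1 (conn_trans hc h2)
      · exact conn_trans h1 (conn_trans (conn_symm hc) h2)
    · exact Or.inl
  unfold Phi clusters
  rw [this]

lemma cluster_insert_in {ends : E → Sym2 V} {ω : Finset E} {e : E} {x y : V}
    (hxy : ends e = s(x, y)) {v : V} (hv : Connected ends ω x v ∨ Connected ends ω y v) :
    cluster ends (insert e ω) v = cluster ends ω x ∪ cluster ends ω y := by
  ext w
  rw [Finset.mem_union, mem_cluster, mem_cluster, mem_cluster, conn_insert hxy]
  constructor
  · rintro (h1 | ⟨h1, h2⟩ | ⟨h1, h2⟩)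
    · exact hv.imp (fun k => conn_trans k h1) (fun k => conn_trans k h1)
    · exact Or.inr h2
    · exact Or.inl h2
  · rintro (h1 | h1)
    · rcases hv with k | k
      · exact Or.inl (conn_trans (conn_symm k) h1)
      · exact Or.inr (Or.inr ⟨conn_symm k, h1⟩)
    · rcases hv with k | k
      · exact Or.inr (Or.inl ⟨conn_symm k, h1⟩)
      · exact Or.inl (conn_trans (conn_symm k) h1)

lemma cluster_insert_out {ends : E → Sym2 V} {ω : Finset E} {e : E} {x y : V}
    (hxy : ends e = s(x, y)) {v : V} (hx : ¬ Connected ends ω x v) (hy : ¬ Connected ends ω y v) :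
    cluster ends (insert e ω) v = cluster ends ω v := by
  ext w
  rw [mem_cluster, mem_cluster, conn_insert hxy]
  constructor
  · rintro (h1 | ⟨h1, h2⟩ | ⟨h1, h2⟩)
    · exact h1
    · exact absurd (conn_symm h1) hx
    · exact absurd (conn_symm h1) hy
  · exact Or.inl

lemma Phi_insert_not_conn (h : ℝ) {ends : E → Sym2 V} {ω : Finset E} {e : E} {x y : V}
    (hxy : ends e = s(x, y)) (hc : ¬ Connected ends ω x y) :
    Phi h ends (insert e ω) *
      (phi h (cluster ends ω x).card * phi h (cluster ends ω y).card) =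
    Phi h ends ω * phi h ((cluster ends ω x).card + (cluster ends ω y).card) := by
  classical
  set Cx := cluster ends ω x with hCx
  set Cy := cluster ends ω y with hCy
  have hne : Cx ≠ Cy := fun k => hc (cluster_eq_iff.1 k)
  have hdisj : Disjoint Cx Cy := by
    rw [Finset.disjoint_left]
    intro u hu hu'
    exact hc (conn_trans (mem_cluster.1 hu) (conn_symm (mem_cluster.1 hu')))
  set R := ((clusters ends ω).erase Cx).erase Cy with hR
  have hyR : Cy ∈ (clusters ends ω).erase Cx :=
    Finset.mem_erase.2 ⟨hne.symm, mem_clusters.2 ⟨y, rfl⟩⟩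
  have hxR : Cx ∈ clusters ends ω := mem_clusters.2 ⟨x, rfl⟩
  have hmemR : ∀ C, C ∈ R ↔ ∃ v, ¬ Connected ends ω x v ∧ ¬ Connected ends ω y v ∧
      cluster ends ω v = C := by
    intro C
    rw [hR, Finset.mem_erase, Finset.mem_erase, mem_clusters]
    constructor
    · rintro ⟨h1, h2, v, rfl⟩
      exact ⟨v, fun k => h2 (cluster_eq_iff.2 k).symm, fun k => h1 (cluster_eq_iff.2 k).symm, rfl⟩
    · rintro ⟨v, h1, h2, rfl⟩
      exact ⟨fun k => h2 (cluster_eq_iff.1 k.symm), fun k => h1 (cluster_eq_iff.1 k.symm), v, rfl⟩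
  have hU : Cx ∪ Cy ∉ R := by
    rw [hmemR]
    rintro ⟨v, h1, h2, h3⟩
    have : v ∈ Cx ∪ Cy := h3 ▸ mem_cluster.2 (conn_refl _ _ _)
    rcases Finset.mem_union.1 this with k | k
    · exact h1 (mem_cluster.1 k)
    · exact h2 (mem_cluster.1 k)
  have hins : clusters ends (insert e ω) = insert (Cx ∪ Cy) R := by
    ext C
    rw [Finset.mem_insert, hmemR, mem_clusters]
    constructor
    · rintro ⟨v, rfl⟩
      by_cases hv : Connected ends ω x v ∨ Connected ends ω y v
      · exact Or.inl (cluster_insert_in hxy hv)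
      · push Not at hv
        exact Or.inr ⟨v, hv.1, hv.2, (cluster_insert_out hxy hv.1 hv.2).symm⟩
    · rintro (rfl | ⟨v, h1, h2, rfl⟩)
      · exact ⟨x, cluster_insert_in hxy (Or.inl (conn_refl _ _ _))⟩
      · exact ⟨v, cluster_insert_out hxy h1 h2⟩
  have e1 : Phi h ends ω = phi h Cx.card * (phi h Cy.card * ∏ C ∈ R, phi h C.card) := by
    unfold Phi
    rw [← Finset.mul_prod_erase _ _ hxR, ← Finset.mul_prod_erase _ _ hyR]
  have e2 : Phi h ends (insert e ω) = phi h (Cx.card + Cy.card) * ∏ C ∈ R, phi h C.card := by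
    unfold Phi
    rw [hins, Finset.prod_insert hU, Finset.card_union_of_disjoint hdisj, Nat.cast_add]
  rw [e1, e2]
  ring

lemma Phi_local (h : ℝ) (ends : E → Sym2 V) {ω ω' : Finset E} (hs : ω ⊆ ω') (e : E) :
    Phi h ends (insert e ω) * Phi h ends ω' ≤ Phi h ends ω * Phi h ends (insert e ω') := by
  obtain ⟨x, y, hxy⟩ : ∃ x y, ends e = s(x, y) := by
    induction hz : ends e with
    | _ x y => exact ⟨x, y, rfl⟩
  by_cases hc : Connected ends ω x y
  · rw [Phi_insert_conn h hxy hc, Phi_insert_conn h hxy (conn_mono hs hc)]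
  · have k1 := Phi_insert_not_conn h hxy hc
    have hp := phi_pos h (cluster ends ω x).card
    have hq := phi_pos h (cluster ends ω y).card
    have hP := Phi_pos h ends ω
    have hP' := Phi_pos h ends ω'
    by_cases hc' : Connected ends ω' x y
    · rw [Phi_insert_conn h hxy hc']
      refine mul_le_mul_of_nonneg_right ?_ hP'.le
      refine le_of_mul_le_mul_right ?_ (mul_pos hp hq)
      rw [k1]
      exact mul_le_mul_of_nonneg_left (phi_add_le _ _ _) hP.le
    · have k2 := Phi_insert_not_conn h hxy hc'
      have hp' := phi_pos h (cluster ends ω' x).card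
      have hq' := phi_pos h (cluster ends ω' y).card
      have k3 := phi_step2 h (cluster ends ω x).card (cluster ends ω' x).card
        (cluster ends ω y).card (cluster ends ω' y).card (Nat.cast_nonneg _)
        (Nat.cast_le.2 (Finset.card_le_card (cluster_mono hs x))) (Nat.cast_nonneg _)
        (Nat.cast_le.2 (Finset.card_le_card (cluster_mono hs y)))
      refine le_of_mul_le_mul_right ?_ (mul_pos (mul_pos hp hq) (mul_pos hp' hq'))
      have k4 := mul_le_mul_of_nonneg_left k3 (mul_pos hP hP').le
      calc _ = (Phi h ends (insert e ω) *
            (phi h (cluster ends ω x).card * phi h (cluster ends ω y).card)) * (Phi h ends ω' *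
            (phi h (cluster ends ω' x).card * phi h (cluster ends ω' y).card)) := by ring
        _ ≤ (Phi h ends (insert e ω') *
            (phi h (cluster ends ω' x).card * phi h (cluster ends ω' y).card)) * (Phi h ends ω *
            (phi h (cluster ends ω x).card * phi h (cluster ends ω y).card)) := by
          rw [k1, k2]; linarith
        _ = _ := by ring

lemma Phi_union (h : ℝ) (ends : E → Sym2 V) {ω ω' : Finset E} (hs : ω ⊆ ω') (S : Finset E) :
    Phi h ends (S ∪ ω) * Phi h ends ω' ≤ Phi h ends ω * Phi h ends (S ∪ ω') := by
  induction S using Finset.induction_on with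
  | empty => simp
  | insert e S _ ih =>
    rw [Finset.insert_union, Finset.insert_union]
    have k := Phi_local h ends (Finset.union_subset_union_right (s := S) hs) e
    have p1 := Phi_pos h ends (S ∪ ω)
    have p2 := Phi_pos h ends (S ∪ ω')
    refine le_of_mul_le_mul_right ?_ (mul_pos p1 p2)
    calc _ = (Phi h ends (insert e (S ∪ ω)) * Phi h ends (S ∪ ω')) *
          (Phi h ends (S ∪ ω) * Phi h ends ω') := by ring
      _ ≤ (Phi h ends (S ∪ ω) * Phi h ends (insert e (S ∪ ω'))) *
          (Phi h ends ω * Phi h ends (S ∪ ω')) :=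
        mul_le_mul k ih (mul_pos p1 (Phi_pos _ _ _)).le (mul_pos p1 (Phi_pos _ _ _)).le
      _ = _ := by ring

lemma rcWeight_eq (β h : ℝ) (ends : E → Sym2 V) (ω : Finset E) :
    rcWeight β h ends ω = (Real.exp (2 * β) - 1) ^ ω.card * Phi h ends ω := rfl

lemma rcWeight_pos {β : ℝ} (hβ : 0 < β) (h : ℝ) (ends : E → Sym2 V) (ω : Finset E) :
    0 < rcWeight β h ends ω := by
  have : 0 < Real.exp (2 * β) - 1 := sub_pos.2 (Real.one_lt_exp_iff.2 (by linarith))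
  exact mul_pos (pow_pos this _) (Phi_pos _ _ _)

lemma rcWeight_lattice {β : ℝ} (hβ : 0 < β) (h : ℝ) (ends : E → Sym2 V) (A B : Finset E) :
    rcWeight β h ends A * rcWeight β h ends B ≤
      rcWeight β h ends (A ∩ B) * rcWeight β h ends (A ∪ B) := by
  have hp : 0 < Real.exp (2 * β) - 1 := sub_pos.2 (Real.one_lt_exp_iff.2 (by linarith))
  have k := Phi_union h ends (Finset.inter_subset_right : A ∩ B ⊆ B) A
  rw [Finset.union_eq_left.2 (Finset.inter_subset_left : A ∩ B ⊆ A)] at k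
  have hcard : (Real.exp (2 * β) - 1) ^ A.card * (Real.exp (2 * β) - 1) ^ B.card =
      (Real.exp (2 * β) - 1) ^ (A ∩ B).card * (Real.exp (2 * β) - 1) ^ (A ∪ B).card := by
    rw [← pow_add, ← pow_add, Finset.card_inter_add_card_union]
  simp only [rcWeight_eq]
  rw [mul_mul_mul_comm, mul_mul_mul_comm _ (Phi h ends (A ∩ B)), ← hcard]
  exact mul_le_mul_of_nonneg_left k (by positivity)

lemma rcZ_pos {β : ℝ} (hβ : 0 < β) (h : ℝ) (ends : E → Sym2 V) : 0 < rcZ β h ends :=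
  Finset.sum_pos (fun ω _ => rcWeight_pos hβ h ends ω) ⟨∅, Finset.mem_univ _⟩

lemma rcProb_sum {β : ℝ} (hβ : 0 < β) (h : ℝ) (ends : E → Sym2 V) :
    ∑ ω : Finset E, rcProb β h ends ω = 1 := by
  unfold rcProb
  rw [← Finset.sum_div]
  exact div_self (rcZ_pos hβ h ends).ne'

end RC


/-- the random-cluster measure with external field satisfies the FKG
inequality: `𝔼[f g] ≥ 𝔼[f] 𝔼[g]` for nondecreasing `f, g`. -/
theorem rc_fkg (V E : Type) [Fintype V] [DecidableEq V] [Fintype E] [DecidableEq E]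
    (β h : ℝ) (hβ : 0 < β) (ends : E → Sym2 V) (f g : Finset E → ℝ)
    (hf : ∀ ω₁ ω₂ : Finset E, ω₁ ⊆ ω₂ → f ω₁ ≤ f ω₂)
    (hg : ∀ ω₁ ω₂ : Finset E, ω₁ ⊆ ω₂ → g ω₁ ≤ g ω₂) :
    RC.rcExp β h ends f * RC.rcExp β h ends g ≤ RC.rcExp β h ends (fun ω => f ω * g ω) := by
  have hZ := RC.rcZ_pos hβ h ends
  have hsum := RC.rcProb_sum hβ h ends
  have key := fkg (μ := RC.rcProb β h ends) (f := fun ω => f ω - f ∅) (g := fun ω => g ω - g ∅)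
    (fun ω => (div_pos (RC.rcWeight_pos hβ h ends ω) hZ).le)
    (fun ω => sub_nonneg.2 (hf _ _ (Finset.empty_subset ω)))
    (fun ω => sub_nonneg.2 (hg _ _ (Finset.empty_subset ω)))
    (fun a b hab => sub_le_sub_right (hf _ _ hab) _)
    (fun a b hab => sub_le_sub_right (hg _ _ hab) _)
    (fun a b => by
      unfold RC.rcProb
      rw [div_mul_div_comm, div_mul_div_comm]
      exact div_le_div_of_nonneg_right (RC.rcWeight_lattice hβ h ends a b) (mul_pos hZ hZ).le)
  have e1 : ∑ a, RC.rcProb β h ends a * (f a - f ∅) = RC.rcExp β h ends f - f ∅ := by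
    simp only [mul_sub, Finset.sum_sub_distrib, ← Finset.sum_mul, hsum, RC.rcExp, one_mul]
    simp only [mul_comm]
  have e2 : ∑ a, RC.rcProb β h ends a * (g a - g ∅) = RC.rcExp β h ends g - g ∅ := by
    simp only [mul_sub, Finset.sum_sub_distrib, ← Finset.sum_mul, hsum, RC.rcExp, one_mul]
    simp only [mul_comm]
  have e3 : ∑ a, RC.rcProb β h ends a * ((f a - f ∅) * (g a - g ∅)) =
      RC.rcExp β h ends (fun ω => f ω * g ω) - f ∅ * RC.rcExp β h ends g
        - g ∅ * RC.rcExp β h ends f + f ∅ * g ∅ := by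
    have : f ∅ * g ∅ = f ∅ * g ∅ * ∑ ω, RC.rcProb β h ends ω := by rw [hsum, mul_one]
    rw [this]
    simp only [RC.rcExp, Finset.mul_sum, ← Finset.sum_sub_distrib, ← Finset.sum_add_distrib]
    exact Finset.sum_congr rfl fun a _ => by ring
  rw [e1, e2, e3, hsum] at key
  linarith
end

section
/- Let G = (V,E) be a finite graph, β > 0 and h ∈ ℝ. The random-cluster measure with external field ℙ_G has the finite energy property: for every edge e ∈ E and every η ⊆ E∖{e}, (e^{2β}−1)/(e^{2β}+1) ≤ ℙ_G( e ∈ ω | ω ∩ (E∖{e}) = η ) ≤ 1 − e^{−2β}. -/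
namespace RC

section Helpers

set_option linter.unusedSectionVars false

variable {V E : Type} [Fintype V] [DecidableEq V] [Fintype E] [DecidableEq E]


lemma Connected.symm' {ends : E → Sym2 V} {ω : Finset E} {a b : V}
    (hab : Connected ends ω a b) : Connected ends ω b a := by
  induction hab with
  | refl => exact Relation.ReflTransGen.refl
  | tail _ hbc ih =>
    obtain ⟨f, hf, hfe⟩ := hbc
    exact Relation.ReflTransGen.head ⟨f, hf, by rw [hfe, Sym2.eq_swap]⟩ ih


lemma Connected.trans' {ends : E → Sym2 V} {ω : Finset E} {a b c : V}
    (hab : Connected ends ω a b) (hbc : Connected ends ω b c) : Connected ends ω a c :=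
  Relation.ReflTransGen.trans hab hbc


lemma connected_insert {ends : E → Sym2 V} {η : Finset E} {e : E} {x y : V}
    (he : ends e = s(x, y)) (a b : V) :
    Connected ends (insert e η) a b ↔ Connected ends η a b ∨
      (Connected ends η a x ∧ Connected ends η y b) ∨
      (Connected ends η a y ∧ Connected ends η x b) := by
  have mono : ∀ {u v}, Connected ends η u v → Connected ends (insert e η) u v := by
    intro u v huv
    induction huv with
    | refl => exact Relation.ReflTransGen.refl
    | tail _ hbc ih =>
      obtain ⟨f, hf, hfe⟩ := hbc
      exact Relation.ReflTransGen.tail ih ⟨f, Finset.mem_insert_of_mem hf, hfe⟩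
  have hxy : Connected ends (insert e η) x y :=
    Relation.ReflTransGen.single ⟨e, Finset.mem_insert_self _ _, he⟩
  constructor
  · intro hab
    induction hab with
    | refl => exact Or.inl Relation.ReflTransGen.refl
    | @tail b c _ hbc ih =>
      obtain ⟨f, hf, hfe⟩ := hbc
      rcases Finset.mem_insert.1 hf with rfl | hf
      · rw [he] at hfe
        rcases Sym2.eq_iff.1 hfe with ⟨rfl, rfl⟩ | ⟨rfl, rfl⟩
        · rcases ih with h | ⟨h, h'⟩ | ⟨h, h'⟩
          · exact Or.inr (Or.inl ⟨h, Relation.ReflTransGen.refl⟩)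
          · exact Or.inr (Or.inl ⟨h, Relation.ReflTransGen.refl⟩)
          · exact Or.inl h
        · rcases ih with h | ⟨h, h'⟩ | ⟨h, h'⟩
          · exact Or.inr (Or.inr ⟨h, Relation.ReflTransGen.refl⟩)
          · exact Or.inl h
          · exact Or.inr (Or.inr ⟨h, Relation.ReflTransGen.refl⟩)
      · have hbc : Connected ends η b c := Relation.ReflTransGen.single ⟨f, hf, hfe⟩
        rcases ih with h | ⟨h, h'⟩ | ⟨h, h'⟩
        · exact Or.inl (h.trans' hbc)
        · exact Or.inr (Or.inl ⟨h, h'.trans' hbc⟩)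
        · exact Or.inr (Or.inr ⟨h, h'.trans' hbc⟩)
  · rintro (h | ⟨h, h'⟩ | ⟨h, h'⟩)
    · exact mono h
    · exact ((mono h).trans' hxy).trans' (mono h')
    · exact ((mono h).trans' hxy.symm').trans' (mono h')


lemma self_mem_cluster {ends : E → Sym2 V} {ω : Finset E} {v : V} :
    v ∈ cluster ends ω v := mem_cluster.2 Relation.ReflTransGen.refl


lemma cluster_eq {ends : E → Sym2 V} {ω : Finset E} {v w : V}
    (h : Connected ends ω v w) : cluster ends ω v = cluster ends ω w := by
  ext u
  rw [mem_cluster, mem_cluster]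
  exact ⟨fun k => h.symm'.trans' k, fun k => h.trans' k⟩

lemma field_bounds (h a b : ℝ) (F : ℝ → ℝ) (hF : ∀ t, F t = Real.exp (h * t) + Real.exp (-(h * t))) :
    F (a + b) ≤ F a * F b ∧ F a * F b ≤ 2 * F (a + b) ∨ (a < 0 ∨ b < 0) := by
  by_cases hab : a < 0 ∨ b < 0
  · exact Or.inr hab
  left
  push Not at hab
  obtain ⟨ha, hb⟩ := hab
  have e1 : F a * F b = F (a + b) + F (a - b) := by
    simp only [hF, add_mul, mul_add, ← Real.exp_add]
    ring_nf
  have e2 : F (a - b) ≤ F (a + b) := by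
    have c : ∀ t, F t = 2 * Real.cosh (h * t) := by
      intro t; rw [hF, Real.cosh_eq]; ring
    rw [c, c]
    have : Real.cosh (h * (a - b)) ≤ Real.cosh (h * (a + b)) := by
      rw [Real.cosh_le_cosh, abs_mul, abs_mul]
      apply mul_le_mul_of_nonneg_left _ (abs_nonneg h)
      rw [abs_of_nonneg (add_nonneg ha hb), abs_le]
      constructor <;> linarith
    linarith
  have e3 : 0 ≤ F (a - b) := by rw [hF]; positivity
  constructor <;> linarith

/-- Product over clusters. -/
noncomputable def cprod (h : ℝ) (ends : E → Sym2 V) (ω : Finset E) : ℝ :=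
  ∏ C ∈ clusters ends ω, (Real.exp (h * C.card) + Real.exp (-(h * C.card)))


lemma cprod_pos (h : ℝ) (ends : E → Sym2 V) (ω : Finset E) : 0 < cprod h ends ω :=
  Finset.prod_pos fun _ _ => by positivity


lemma cprod_bounds (h : ℝ) (ends : E → Sym2 V) (η : Finset E) (e : E) :
    cprod h ends (insert e η) ≤ cprod h ends η ∧
      cprod h ends η ≤ 2 * cprod h ends (insert e η) := by
  classical
  obtain ⟨x, y, he⟩ : ∃ x y, ends e = s(x, y) := by
    induction hh : ends e with
    | _ x y => exact ⟨x, y, rfl⟩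
  by_cases hxy : Connected ends η x y
  · have : clusters ends (insert e η) = clusters ends η := by
      have hc : cluster ends (insert e η) = cluster ends η := by
        funext v
        ext w
        rw [mem_cluster, mem_cluster, connected_insert he]
        constructor
        · rintro (k | ⟨k, k'⟩ | ⟨k, k'⟩)
          · exact k
          · exact (k.trans' hxy).trans' k'
          · exact (k.trans' hxy.symm').trans' k'
        · exact Or.inl
      simp only [clusters, hc]
    have hp := cprod_pos h ends η
    have : cprod h ends (insert e η) = cprod h ends η := by simp only [cprod, this]
    rw [this]
    constructor <;> linarith
  · set X := cluster ends η x with hX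
    set Y := cluster ends η y with hY
    set R : Finset (Finset V) :=
      (Finset.univ.filter (fun v => v ∉ X ∧ v ∉ Y)).image (cluster ends η) with hR
    have hRx : ∀ C ∈ R, x ∉ C ∧ y ∉ C := by
      intro C hC
      obtain ⟨v, hv, rfl⟩ := Finset.mem_image.1 hC
      have hv := (Finset.mem_filter.1 hv).2
      exact ⟨fun k => hv.1 (mem_cluster.2 (mem_cluster.1 k).symm'),
        fun k => hv.2 (mem_cluster.2 (mem_cluster.1 k).symm')⟩
    have hxX : x ∈ X := self_mem_cluster
    have hyY : y ∈ Y := self_mem_cluster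
    have hyX : y ∉ X := fun k => hxy (mem_cluster.1 k)
    have hXR : X ∉ R := fun k => (hRx _ k).1 hxX
    have hYR : Y ∉ R := fun k => (hRx _ k).2 hyY
    have hXYR : X ∪ Y ∉ R := fun k => (hRx _ k).1 (Finset.mem_union_left _ hxX)
    have hXY : X ≠ Y := fun k => hyX (k ▸ hyY)
    have hdisj : Disjoint X Y := by
      rw [Finset.disjoint_left]
      intro w h1 h2
      exact hxy ((mem_cluster.1 h1).trans' (mem_cluster.1 h2).symm')
    have c0 : clusters ends η = insert X (insert Y R) := by
      ext C
      simp only [clusters, hR, Finset.mem_image, Finset.mem_insert, Finset.mem_filter,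
        Finset.mem_univ, true_and]
      constructor
      · rintro ⟨v, rfl⟩
        by_cases h1 : v ∈ X
        · exact Or.inl (cluster_eq (mem_cluster.1 h1)).symm
        by_cases h2 : v ∈ Y
        · exact Or.inr (Or.inl (cluster_eq (mem_cluster.1 h2)).symm)
        exact Or.inr (Or.inr ⟨v, ⟨h1, h2⟩, rfl⟩)
      · rintro (rfl | rfl | ⟨v, _, rfl⟩)
        exacts [⟨x, rfl⟩, ⟨y, rfl⟩, ⟨v, rfl⟩]
    have k1 : ∀ v, v ∈ X ∨ v ∈ Y → cluster ends (insert e η) v = X ∪ Y := by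
      intro v hv
      ext w
      rw [mem_cluster, connected_insert he, Finset.mem_union, mem_cluster, mem_cluster]
      rw [mem_cluster, mem_cluster] at hv
      constructor
      · rintro (k | ⟨k, k'⟩ | ⟨k, k'⟩)
        · exact hv.imp (fun j => j.trans' k) (fun j => j.trans' k)
        · exact Or.inr k'
        · exact Or.inl k'
      · rcases hv with hv | hv
        · rintro (k | k)
          · exact Or.inl (hv.symm'.trans' k)
          · exact Or.inr (Or.inl ⟨hv.symm', k⟩)
        · rintro (k | k)
          · exact Or.inr (Or.inr ⟨hv.symm', k⟩)
          · exact Or.inl (hv.symm'.trans' k)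
    have k2 : ∀ v, v ∉ X → v ∉ Y → cluster ends (insert e η) v = cluster ends η v := by
      intro v h1 h2
      ext w
      rw [mem_cluster, connected_insert he, mem_cluster]
      rw [mem_cluster] at h1 h2
      constructor
      · rintro (k | ⟨k, k'⟩ | ⟨k, k'⟩)
        · exact k
        · exact absurd k.symm' h1
        · exact absurd k.symm' h2
      · exact Or.inl
    have c1 : clusters ends (insert e η) = insert (X ∪ Y) R := by
      ext C
      simp only [clusters, hR, Finset.mem_image, Finset.mem_insert, Finset.mem_filter,
        Finset.mem_univ, true_and]
      constructor
      · rintro ⟨v, rfl⟩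
        by_cases h1 : v ∈ X
        · exact Or.inl (k1 v (Or.inl h1))
        by_cases h2 : v ∈ Y
        · exact Or.inl (k1 v (Or.inr h2))
        exact Or.inr ⟨v, ⟨h1, h2⟩, (k2 v h1 h2).symm⟩
      · rintro (rfl | ⟨v, hv, rfl⟩)
        exacts [⟨x, k1 x (Or.inl hxX)⟩, ⟨v, k2 v hv.1 hv.2⟩]
    have hXn : X ∉ insert Y R := by
      simp only [Finset.mem_insert, not_or]
      exact ⟨hXY, hXR⟩
    have hb := field_bounds h X.card Y.card
      (fun t => Real.exp (h * t) + Real.exp (-(h * t))) (fun _ => rfl)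
    have hb := hb.resolve_right (by
      rintro (k | k)
      · exact absurd k (not_lt.2 (Nat.cast_nonneg _))
      · exact absurd k (not_lt.2 (Nat.cast_nonneg _)))
    have hRp : 0 < ∏ C ∈ R, (Real.exp (h * C.card) + Real.exp (-(h * C.card))) :=
      Finset.prod_pos fun _ _ => by positivity
    unfold cprod
    rw [c0, c1, Finset.prod_insert hXn, Finset.prod_insert hYR, Finset.prod_insert hXYR,
      Finset.card_union_of_disjoint hdisj, Nat.cast_add, ← mul_assoc, ← mul_assoc]
    exact ⟨mul_le_mul_of_nonneg_right hb.1 hRp.le, mul_le_mul_of_nonneg_right hb.2 hRp.le⟩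

end Helpers

end RC

/-- finite energy property of the random-cluster measure with external field:
`(e^{2β}-1)/(e^{2β}+1) ≤ ℙ(e ∈ ω | ω ∩ (E∖{e}) = η) ≤ 1 - e^{-2β}`. -/
theorem rc_finite_energy (V E : Type) [Fintype V] [DecidableEq V] [Fintype E] [DecidableEq E]
    (β h : ℝ) (hβ : 0 < β) (ends : E → Sym2 V) (e : E) (η : Finset E) (hη : e ∉ η) :
    (Real.exp (2 * β) - 1) / (Real.exp (2 * β) + 1) ≤
        RC.rcCondPr β h ends (fun ω => e ∈ ω) (fun ω => ω.erase e = η) ∧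
      RC.rcCondPr β h ends (fun ω => e ∈ ω) (fun ω => ω.erase e = η) ≤
        1 - Real.exp (-(2 * β)) := by
  classical
  have hp : 0 < Real.exp (2 * β) - 1 := by
    have := Real.one_lt_exp_iff.2 (show 0 < 2 * β by linarith)
    linarith
  obtain ⟨hb1, hb2⟩ := RC.cprod_bounds h ends η e
  have hP1 := RC.cprod_pos h ends (insert e η)
  have hP0 := RC.cprod_pos h ends η
  have hw : ∀ ω, RC.rcWeight β h ends ω =
      (Real.exp (2 * β) - 1) ^ ω.card * RC.cprod h ends ω := fun _ => rfl
  have hZ : 0 < RC.rcZ β h ends := by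
    refine Finset.sum_pos (fun ω _ => ?_) Finset.univ_nonempty
    rw [hw]
    exact mul_pos (pow_pos hp _) (RC.cprod_pos _ _ _)
  have hne : η ≠ insert e η := fun k => hη (by rw [k]; exact Finset.mem_insert_self _ _)
  have hE : ∀ ω : Finset E, ω.erase e = η ↔ ω = η ∨ ω = insert e η := by
    intro ω
    constructor
    · intro k
      by_cases hω : e ∈ ω
      · right; rw [← k, Finset.insert_erase hω]
      · left; rw [← k, Finset.erase_eq_of_notMem hω]
    · rintro (rfl | rfl)
      · exact Finset.erase_eq_of_notMem hη
      · exact Finset.erase_insert hη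
  have hnum : RC.rcPr β h ends (fun ω => e ∈ ω ∧ ω.erase e = η) =
      RC.rcProb β h ends (insert e η) := by
    unfold RC.rcPr
    rw [Finset.sum_eq_single (insert e η)]
    · rw [if_pos ⟨Finset.mem_insert_self _ _, Finset.erase_insert hη⟩]
    · intro ω _ hω
      rw [if_neg]
      rintro ⟨k1, k2⟩
      rcases (hE ω).1 k2 with rfl | k
      · exact hη k1
      · exact hω k
    · intro k
      exact absurd (Finset.mem_univ _) k
  have hden : RC.rcPr β h ends (fun ω => ω.erase e = η) =
      RC.rcProb β h ends η + RC.rcProb β h ends (insert e η) := by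
    unfold RC.rcPr
    trans ∑ ω : Finset E, ((if ω = η then RC.rcProb β h ends ω else 0) +
      (if ω = insert e η then RC.rcProb β h ends ω else 0))
    · refine Finset.sum_congr rfl (fun ω _ => ?_)
      by_cases h1 : ω = η
      · rw [if_pos ((hE ω).2 (Or.inl h1)), if_pos h1, if_neg (fun k => hne (h1.symm.trans k)),
          add_zero]
      · by_cases h2 : ω = insert e η
        · rw [if_pos ((hE ω).2 (Or.inr h2)), if_neg h1, if_pos h2, zero_add]
        · rw [if_neg (fun k => ((hE ω).1 k).elim h1 h2), if_neg h1, if_neg h2, zero_add]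
    · rw [Finset.sum_add_distrib, Finset.sum_ite_eq' , Finset.sum_ite_eq',
        if_pos (Finset.mem_univ _), if_pos (Finset.mem_univ _)]
  have hval : RC.rcCondPr β h ends (fun ω => e ∈ ω) (fun ω => ω.erase e = η) =
      (Real.exp (2 * β) - 1) * RC.cprod h ends (insert e η) /
        (RC.cprod h ends η + (Real.exp (2 * β) - 1) * RC.cprod h ends (insert e η)) := by
    unfold RC.rcCondPr
    rw [hnum, hden]
    unfold RC.rcProb
    rw [← add_div, div_div_div_cancel_right₀ hZ.ne', hw, hw, Finset.card_insert_of_notMem hη,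
      pow_succ]
    have hq := pow_pos hp η.card
    rw [mul_assoc, ← mul_add, mul_div_mul_left _ _ hq.ne']
  rw [hval]
  have hexp : 1 - Real.exp (-(2 * β)) = (Real.exp (2 * β) - 1) / Real.exp (2 * β) := by
    rw [Real.exp_neg]
    field_simp
  have hexp0 := Real.exp_pos (2 * β)
  rw [hexp]
  generalize Real.exp (2 * β) = t at *
  have hD : 0 < RC.cprod h ends η + (t - 1) * RC.cprod h ends (insert e η) :=
    add_pos hP0 (mul_pos hp hP1)
  constructor
  · rw [div_le_div_iff₀ (by linarith) hD]
    nlinarith [mul_le_mul_of_nonneg_left hb2 hp.le]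
  · rw [div_le_div_iff₀ hD hexp0]
    nlinarith [mul_le_mul_of_nonneg_left hb1 hp.le]
end
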